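/- Let f ∈ F[Y ∪ Z] be a homogeneous polynomial of degree d, and suppose f = Σ_{i=1}^k P_i where each P_i is a product of finitely many homogeneous linear forms in the variables Y ∪ Z (a homogeneous ΣΠΣ representation with top fan-in k). Then maxrank(M_f) ≤ k · 2^d. -/

import Mathlib

open scoped Classical

noncomputable section

namespace PCM

variable {F : Type} [Field F] {Y Z : Type} [Fintype Y] [Fintype Z]

/-- Exponent vector of the monic multilinear monomial `∏_{y ∈ p} y · ∏_{z ∈ q} z`. -/
def mexp (p : Finset Y) (q : Finset Z) : (Y ⊕ Z) →₀ ℕ :=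
  (∑ y ∈ p, Finsupp.single (Sum.inl y) 1) + ∑ z ∈ q, Finsupp.single (Sum.inr z) 1

/-- The polynomial coefficient matrix `M_f`. -/
def coeffMatrix (f : MvPolynomial (Y ⊕ Z) F) :
    Matrix (Finset Y) (Finset Z) (MvPolynomial (Y ⊕ Z) F) := fun p q =>
  ∑ d ∈ f.support,
    if d.support ⊆ p.image Sum.inl ∪ q.image Sum.inr ∧ mexp p q ≤ d then
      MvPolynomial.monomial (d - mexp p q) (MvPolynomial.coeff d f)
    else 0

/-- `maxrank(M_f)`: the maximum, over substitutions `S`, of the rank of `M_f|_S`. -/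
def maxrank (f : MvPolynomial (Y ⊕ Z) F) : ℕ :=
  ⨆ S : (Y ⊕ Z) → F, ((coeffMatrix f).map (MvPolynomial.eval S)).rank

/-- The partial derivatives matrix `L_f`. -/
def pdMatrix (f : MvPolynomial (Y ⊕ Z) F) : Matrix (Finset Y) (Finset Z) F := fun p q =>
  MvPolynomial.coeff (mexp p q) f

end PCM

namespace PCM

open MvPolynomial

/-- The linear functional sending `f` to the value at `S` of the polynomial obtained from the
part of `f` with monomials of support exactly `s` by dividing by `∏ x ∈ s, x`. -/
def supportEval {F σ : Type} [Field F] (S : σ → F) (s : Finset σ) : MvPolynomial σ F →ₗ[F] F :=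
  (basisMonomials σ F).constr F fun u =>
    if u.support = s then u.prod fun x e => S x ^ (e - 1) else 0

lemma supportEval_monomial {F σ : Type} [Field F] (S : σ → F) (s : Finset σ) (u : σ →₀ ℕ)
    (a : F) : supportEval S s (monomial u a) =
      a * if u.support = s then u.prod fun x e => S x ^ (e - 1) else 0 := by
  have h : monomial u a = a • basisMonomials σ F u := by
    rw [coe_basisMonomials, smul_monomial, smul_eq_mul, mul_one]
  rw [h, map_smul, supportEval, Module.Basis.constr_basis, smul_eq_mul]

lemma mexp_inl {Y Z : Type} (p : Finset Y) (q : Finset Z) (y : Y) :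
    mexp p q (Sum.inl y) = if y ∈ p then 1 else 0 := by
  simp [mexp, Finsupp.single_apply]

lemma mexp_inr {Y Z : Type} (p : Finset Y) (q : Finset Z) (z : Z) :
    mexp p q (Sum.inr z) = if z ∈ q then 1 else 0 := by
  simp [mexp, Finsupp.single_apply]

lemma support_subset_and_mexp_le_iff {Y Z : Type} (p : Finset Y) (q : Finset Z)
    (u : Y ⊕ Z →₀ ℕ) :
    (u.support ⊆ p.image Sum.inl ∪ q.image Sum.inr ∧ mexp p q ≤ u) ↔
      u.support = p.disjSum q := by
  constructor
  · rintro ⟨h₁, h₂⟩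
    ext (y | z)
    · have h := h₂ (Sum.inl y)
      have h' := @h₁ (Sum.inl y)
      rw [mexp_inl] at h
      simp at h' ⊢
      grind
    · have h := h₂ (Sum.inr z)
      have h' := @h₁ (Sum.inr z)
      rw [mexp_inr] at h
      simp at h' ⊢
      grind
  · intro h
    constructor
    · rw [h]
      rintro (y | z) <;> simp
    · rintro (y | z)
      · have := Finset.ext_iff.1 h (Sum.inl y)
        rw [mexp_inl]
        simp at this
        grind
      · have := Finset.ext_iff.1 h (Sum.inr z)
        rw [mexp_inr]
        simp at this
        grind

lemma eval_coeffMatrix {F : Type} [Field F] {Y Z : Type} [Fintype Y] [Fintype Z]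
    (f : MvPolynomial (Y ⊕ Z) F) (S : Y ⊕ Z → F) (p : Finset Y) (q : Finset Z) :
    eval S (coeffMatrix f p q) = supportEval S (p.disjSum q) f := by
  conv_rhs => rw [f.as_sum]
  rw [coeffMatrix, map_sum, map_sum]
  refine Finset.sum_congr rfl fun u _ => ?_
  simp only [supportEval_monomial, support_subset_and_mexp_le_iff]
  split_ifs with h
  · rw [eval_monomial, Finsupp.prod_fintype _ _ (by simp), Finsupp.prod_fintype _ _ (by simp)]
    congr 1
    refine Finset.prod_congr rfl ?_
    rintro (y | z) -
    · have := Finset.ext_iff.1 h (Sum.inl y)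
      rw [Finsupp.tsub_apply, mexp_inl]
      simp at this
      split_ifs with hy
      · rfl
      · rw [show u (Sum.inl y) = 0 by tauto]
    · have := Finset.ext_iff.1 h (Sum.inr z)
      rw [Finsupp.tsub_apply, mexp_inr]
      simp at this
      split_ifs with hz
      · rfl
      · rw [show u (Sum.inr z) = 0 by tauto]
  · simp

lemma support_mapDomain_inl_add_inr {Y Z : Type} (u : Y →₀ ℕ) (v : Z →₀ ℕ) :
    (u.mapDomain Sum.inl + v.mapDomain Sum.inr : Y ⊕ Z →₀ ℕ).support =
      u.support.disjSum v.support := by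
  ext (y | z)
  · simp [Finsupp.mapDomain_apply Sum.inl_injective, Finsupp.mapDomain_of_notMem_range]
  · simp [Finsupp.mapDomain_apply Sum.inr_injective, Finsupp.mapDomain_of_notMem_range]

lemma supportEval_rename_mul {F : Type} [Field F] {Y Z : Type} [Fintype Y] [Fintype Z]
    (S : Y ⊕ Z → F) (p : Finset Y) (q : Finset Z) (g : MvPolynomial Y F)
    (h : MvPolynomial Z F) :
    supportEval S (p.disjSum q) (rename Sum.inl g * rename Sum.inr h) =
      supportEval (S ∘ Sum.inl) p g * supportEval (S ∘ Sum.inr) q h := by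
  induction g using MvPolynomial.induction_on' with
  | add g₁ g₂ h₁ h₂ => simp only [map_add, add_mul, h₁, h₂]
  | monomial u a =>
    induction h using MvPolynomial.induction_on' with
    | add g₁ g₂ h₁ h₂ => simp only [map_add, mul_add, h₁, h₂]
    | monomial v b =>
      have hs : u.support.disjSum v.support = p.disjSum q ↔ u.support = p ∧ v.support = q := by
        simp [Finset.ext_iff]
      rw [rename_monomial, rename_monomial, monomial_mul, supportEval_monomial,
        supportEval_monomial, supportEval_monomial, support_mapDomain_inl_add_inr]
      simp only [hs]
      by_cases hu : u.support = p
      · by_cases hv : v.support = q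
        · rw [if_pos ⟨hu, hv⟩, if_pos hu, if_pos hv, Finsupp.prod_fintype _ _ (by simp),
            Finsupp.prod_fintype _ _ (by simp), Finsupp.prod_fintype _ _ (by simp),
            Fintype.prod_sum_type]
          simp [Finsupp.mapDomain_apply Sum.inl_injective,
            Finsupp.mapDomain_apply Sum.inr_injective, Finsupp.mapDomain_of_notMem_range]
          ring
        · simp [hv]
      · simp [hu]

/-- The evaluated polynomial coefficient matrix, as a linear function of the polynomial. -/
def evalCoeffMatrix {F : Type} [Field F] {Y Z : Type} (S : Y ⊕ Z → F) :
    MvPolynomial (Y ⊕ Z) F →ₗ[F] Matrix (Finset Y) (Finset Z) F where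
  toFun f := Matrix.of fun p q => supportEval S (p.disjSum q) f
  map_add' f g := by ext; simp
  map_smul' a f := by ext; simp

lemma rank_sum_le {F ι m n : Type} [Field F] [Fintype m] [Fintype n] (s : Finset ι)
    (A : ι → Matrix m n F) : (∑ i ∈ s, A i).rank ≤ ∑ i ∈ s, (A i).rank := by
  refine Finset.le_sum_of_subadditive Matrix.rank (by simp) (fun B C => ?_) s A
  rw [Matrix.rank, Matrix.mulVecLin_add]
  exact (Submodule.finrank_mono (LinearMap.range_add_le _ _)).trans
    (Submodule.finrank_add_le_finrank_add_finrank _ _)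

lemma exists_rename_add_rename_of_isHomogeneous_one {F : Type} [Field F] {Y Z : Type}
    (l : MvPolynomial (Y ⊕ Z) F) (hl : l.IsHomogeneous 1) :
    ∃ (a : MvPolynomial Y F) (b : MvPolynomial Z F), l = rename Sum.inl a + rename Sum.inr b := by
  have h : l ∈ Submodule.span F (Set.range X) := by
    rwa [← homogeneousSubmodule_one_eq_span_X, mem_homogeneousSubmodule]
  induction h using Submodule.span_induction with
  | mem x hx =>
    obtain ⟨y | z, rfl⟩ := hx
    · exact ⟨X y, 0, by simp⟩
    · exact ⟨0, X z, by simp⟩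
  | zero => exact ⟨0, 0, by simp⟩
  | add x y hx hy h₁ h₂ =>
    rw [← homogeneousSubmodule_one_eq_span_X, mem_homogeneousSubmodule] at hx hy
    obtain ⟨a, b, rfl⟩ := h₁ hx
    obtain ⟨a', b', rfl⟩ := h₂ hy
    exact ⟨a + a', b + b', by simp only [map_add]; ring⟩
  | smul c x hx h₁ =>
    rw [← homogeneousSubmodule_one_eq_span_X, mem_homogeneousSubmodule] at hx
    obtain ⟨a, b, rfl⟩ := h₁ hx
    exact ⟨c • a, c • b, by simp only [map_smul, smul_add]⟩

lemma rank_evalCoeffMatrix_prod_le {F : Type} [Field F] {Y Z : Type} [Fintype Y] [Fintype Z]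
    (S : Y ⊕ Z → F) (s : Finset ℕ) (l : ℕ → MvPolynomial (Y ⊕ Z) F)
    (hl : ∀ j ∈ s, (l j).IsHomogeneous 1) :
    (evalCoeffMatrix S (∏ j ∈ s, l j)).rank ≤ 2 ^ s.card := by
  choose! a b hab using fun j hj => exists_rename_add_rename_of_isHomogeneous_one (l j) (hl j hj)
  rw [Finset.prod_congr rfl hab, Finset.prod_add, map_sum]
  refine (rank_sum_le _ _).trans ?_
  rw [← Finset.card_powerset, Finset.card_eq_sum_ones]
  refine Finset.sum_le_sum fun t _ => ?_
  have h : evalCoeffMatrix S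
      ((∏ j ∈ t, rename Sum.inl (a j)) * ∏ j ∈ s \ t, rename Sum.inr (b j)) =
      Matrix.vecMulVec (fun p => supportEval (S ∘ Sum.inl) p (∏ j ∈ t, a j))
        (fun q => supportEval (S ∘ Sum.inr) q (∏ j ∈ s \ t, b j)) := by
    ext p q
    rw [← map_prod, ← map_prod, Matrix.vecMulVec_apply, ← supportEval_rename_mul]
    rfl
  rw [h]
  exact Matrix.rank_vecMulVec_le _ _

end PCM

/-- if a homogeneous polynomial `f` of degree `d` has a homogeneous ΣΠΣ
representation with top fan-in `k` (each `Pᵢ` a product of homogeneous linear forms),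
then `maxrank(M_f) ≤ k · 2^d`. -/
theorem maxrank_le_of_hom_sps {F : Type} [Field F] {Y Z : Type} [Fintype Y] [Fintype Z]
    (f : MvPolynomial (Y ⊕ Z) F) (d k : ℕ) (hf : f.IsHomogeneous d)
    (m : ℕ → ℕ) (l : ℕ → ℕ → MvPolynomial (Y ⊕ Z) F)
    (hl : ∀ i ∈ Finset.range k, ∀ j ∈ Finset.range (m i), (l i j).IsHomogeneous 1)
    (hrep : f = ∑ i ∈ Finset.range k, ∏ j ∈ Finset.range (m i), l i j) :
    PCM.maxrank f ≤ k * 2 ^ d := by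
  refine ciSup_le' fun S => ?_
  have hM : (PCM.coeffMatrix f).map (MvPolynomial.eval S) = PCM.evalCoeffMatrix S f := by
    ext p q
    exact PCM.eval_coeffMatrix f S p q
  have hhom : ∀ i ∈ Finset.range k,
      (∏ j ∈ Finset.range (m i), l i j).IsHomogeneous (m i) := fun i hi => by
    simpa using MvPolynomial.IsHomogeneous.prod (Finset.range (m i)) (l i) (fun _ => 1) (hl i hi)
  have hf' : f = ∑ i ∈ Finset.range k,
      if d = m i then ∏ j ∈ Finset.range (m i), l i j else 0 := by
    rw [← MvPolynomial.homogeneousComponent_eq_self hf, hrep, map_sum]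
    exact Finset.sum_congr rfl fun i hi =>
      MvPolynomial.homogeneousComponent_of_mem (hhom i hi)
  rw [hM, hf', map_sum]
  refine (PCM.rank_sum_le _ _).trans ?_
  refine (Finset.sum_le_card_nsmul _ _ (2 ^ d) fun i hi => ?_).trans (by simp)
  split_ifs with h
  · simpa [h] using PCM.rank_evalCoeffMatrix_prod_le S (Finset.range (m i)) (l i) (hl i hi)
  · simp
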